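/- Let δ > 0, suppose p ≥ d + 1, and let S ∈ St(d,p)^{⊗n} be a second-order critical point of f satisfying the proximity condition d_F(S,Z) ≤ δ√(d/n)·‖Δ‖_op. If n > 3δ²d‖Δ‖_op²/(2n) + δ√(d/n)·‖Δ‖_op·max_{1≤i≤n}‖Δ_i‖_op + max_{1≤i≤n}‖Δ_iᵀZ‖_op + ‖Δ‖_op, then SSᵀ is the unique global maximizer of the SDP relaxation, rank(SSᵀ) = d, and ⟨A, SSᵀ⟩ equals the maximum value of the program (P); in particular SSᵀ = R̂R̂ᵀ for some global maximizer R̂ of (P) with orthogonal d×d blocks. -/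

import Mathlib

open Matrix MeasureTheory ProbabilityTheory
open scoped BigOperators ENNReal

noncomputable section

/-- Frobenius inner product `⟨X, Y⟩ = Tr (X Yᵀ)`. -/
def finner {m k : Type*} [Fintype m] [Fintype k] (X Y : Matrix m k ℝ) : ℝ :=
  ∑ i, ∑ j, X i j * Y i j

/-- Frobenius norm. -/
def frobNorm {m k : Type*} [Fintype m] [Fintype k] (X : Matrix m k ℝ) : ℝ :=
  Real.sqrt (∑ i, ∑ j, (X i j) ^ 2)

/-- Spectral (ℓ²-operator) norm of a real matrix. -/
def opNorm {m k : Type*} [Fintype m] [Fintype k] [DecidableEq k] (X : Matrix m k ℝ) : ℝ :=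
  ‖LinearMap.toContinuousLinearMap (Matrix.toEuclideanLin X)‖

/-- The `(i,j)` d×d block of an (nd)×(nd) matrix. -/
def blk {n d : ℕ} (M : Matrix (Fin n × Fin d) (Fin n × Fin d) ℝ) (i j : Fin n) :
    Matrix (Fin d) (Fin d) ℝ := fun k l => M (i, k) (j, l)

/-- The i-th d×p block row of an (nd)×p matrix. -/
def rowBlk {n d p : ℕ} (S : Matrix (Fin n × Fin d) (Fin p) ℝ) (i : Fin n) :
    Matrix (Fin d) (Fin p) ℝ := fun k l => S (i, k) l

/-- The i-th (nd)×d block column of an (nd)×(nd) matrix. -/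
def colBlk {n d : ℕ} (M : Matrix (Fin n × Fin d) (Fin n × Fin d) ℝ) (i : Fin n) :
    Matrix (Fin n × Fin d) (Fin d) ℝ := fun q l => M q (i, l)

/-- All d×p block rows lie in the Stiefel manifold St(d,p) (for p = d: are orthogonal). -/
def StiefelBlocks {n d p : ℕ} (S : Matrix (Fin n × Fin d) (Fin p) ℝ) : Prop :=
  ∀ i, rowBlk S i * (rowBlk S i)ᵀ = 1

/-- The vertical stack Z of n copies of the identity I_d. -/
def Zmat (n d : ℕ) : Matrix (Fin n × Fin d) (Fin d) ℝ := fun q l => if q.2 = l then 1 else 0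

/-- Feasibility for the SDP relaxation: symmetric, PSD, identity diagonal blocks. -/
def sdpFeasible {n d : ℕ} (X : Matrix (Fin n × Fin d) (Fin n × Fin d) ℝ) : Prop :=
  X.IsSymm ∧ X.PosSemidef ∧ ∀ i, blk X i i = 1

/-- Global maximizer of the SDP relaxation with data `A`. -/
def sdpMaximizer {n d : ℕ} (A X : Matrix (Fin n × Fin d) (Fin n × Fin d) ℝ) : Prop :=
  sdpFeasible X ∧ ∀ Y, sdpFeasible Y → finner A Y ≤ finner A X

/-- Global maximizer of the program (P) with data `A`. -/
def progPMaximizer {n d : ℕ} (A : Matrix (Fin n × Fin d) (Fin n × Fin d) ℝ)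
    (R : Matrix (Fin n × Fin d) (Fin d) ℝ) : Prop :=
  StiefelBlocks R ∧
    ∀ R' : Matrix (Fin n × Fin d) (Fin d) ℝ, StiefelBlocks R' →
      finner A (R' * R'ᵀ) ≤ finner A (R * Rᵀ)

/-- The distance `d_F(S, Z) = min_{Q ∈ St(d,p)} ‖S − ZQ‖_F`. -/
def dF {n d p : ℕ} (S : Matrix (Fin n × Fin d) (Fin p) ℝ) : ℝ :=
  sInf {c | ∃ Q : Matrix (Fin d) (Fin p) ℝ, Q * Qᵀ = 1 ∧ c = frobNorm (S - Zmat n d * Q)}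

/-- `Λ_{ii}(S) = (1/2) Σ_j (S_i S_jᵀ A_{ji} + A_{ij} S_j S_iᵀ)`. -/
def Lam {n d p : ℕ} (A : Matrix (Fin n × Fin d) (Fin n × Fin d) ℝ)
    (S : Matrix (Fin n × Fin d) (Fin p) ℝ) (i : Fin n) : Matrix (Fin d) (Fin d) ℝ :=
  (1 / 2 : ℝ) •
    ∑ j, (rowBlk S i * (rowBlk S j)ᵀ * blk A j i + blk A i j * rowBlk S j * (rowBlk S i)ᵀ)

/-- Block diagonal matrix with given d×d diagonal blocks. -/
def blkDiag {n d : ℕ} (D : Fin n → Matrix (Fin d) (Fin d) ℝ) :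
    Matrix (Fin n × Fin d) (Fin n × Fin d) ℝ :=
  fun q r => if q.1 = r.1 then D q.1 q.2 r.2 else 0

/-- Local maximizer of `f(S) = ⟨A, S Sᵀ⟩` over `St(d,p)^{⊗n}`. -/
def isLocalMax {n d p : ℕ} (A : Matrix (Fin n × Fin d) (Fin n × Fin d) ℝ)
    (S : Matrix (Fin n × Fin d) (Fin p) ℝ) : Prop :=
  StiefelBlocks S ∧ ∃ ε > (0 : ℝ), ∀ S' : Matrix (Fin n × Fin d) (Fin p) ℝ,
    StiefelBlocks S' → frobNorm (S' - S) < ε → finner A (S' * S'ᵀ) ≤ finner A (S * Sᵀ)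

/-- First-order criticality: `Σ_j A_{ij} S_j = Λ_{ii}(S) S_i` for all i. -/
def firstOrderCrit {n d p : ℕ} (A : Matrix (Fin n × Fin d) (Fin n × Fin d) ℝ)
    (S : Matrix (Fin n × Fin d) (Fin p) ℝ) : Prop :=
  ∀ i, (∑ j, blk A i j * rowBlk S j) = Lam A S i * rowBlk S i

/-- Second-order necessary inequality over tangent directions. -/
def secondOrderIneq {n d p : ℕ} (A : Matrix (Fin n × Fin d) (Fin n × Fin d) ℝ)
    (S : Matrix (Fin n × Fin d) (Fin p) ℝ) : Prop :=
  ∀ Y : Matrix (Fin n × Fin d) (Fin p) ℝ,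
    (∀ i, rowBlk S i * (rowBlk Y i)ᵀ + rowBlk Y i * (rowBlk S i)ᵀ = 0) →
    ∑ i, ∑ j, finner (blk A i j) (rowBlk Y i * (rowBlk Y j)ᵀ) ≤
      ∑ i, finner (Lam A S i) (rowBlk Y i * (rowBlk Y i)ᵀ)

/-- Second-order critical point of `f`. -/
def secondOrderCrit {n d p : ℕ} (A : Matrix (Fin n × Fin d) (Fin n × Fin d) ℝ)
    (S : Matrix (Fin n × Fin d) (Fin p) ℝ) : Prop :=
  StiefelBlocks S ∧ firstOrderCrit A S ∧ secondOrderIneq A S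

/-- Partial trace `Tr_d(Δ) ∈ ℝ^{n×n}`. -/
def partialTrace {n d : ℕ} (Δ : Matrix (Fin n × Fin d) (Fin n × Fin d) ℝ) :
    Matrix (Fin n) (Fin n) ℝ := fun i j => (blk Δ i j).trace

/-- Singular values of a d×p real matrix (square roots of the eigenvalues of `M Mᴴ`). -/
def singVals {d p : ℕ} (M : Matrix (Fin d) (Fin p) ℝ) (i : Fin d) : ℝ :=
  Real.sqrt ((Matrix.isHermitian_mul_conjTranspose_self M).eigenvalues i)

/-- Nuclear norm: sum of singular values. -/
def nuclearNorm {d p : ℕ} (M : Matrix (Fin d) (Fin p) ℝ) : ℝ :=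
  ∑ i, singVals M i

/-- The law of the iid standard Gaussian coordinates indexing the noise. -/
def gaussianEnsemble (n d : ℕ) :
    Measure (((Fin n × Fin d) × (Fin n × Fin d)) → ℝ) :=
  Measure.pi fun _ => gaussianReal 0 1

/-- The symmetric Gaussian random matrix `W` built from the iid coordinates:
`W_{ii} = 0`, the entries of `W_{ij}` for `i < j` are iid standard Gaussians, and
`W_{ji} = W_{ij}ᵀ`. -/
def Wof {n d : ℕ} (ω : ((Fin n × Fin d) × (Fin n × Fin d)) → ℝ) :
    Matrix (Fin n × Fin d) (Fin n × Fin d) ℝ :=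
  fun q r => if q.1 < r.1 then ω (q, r) else if r.1 < q.1 then ω (r, q) else 0

section EuclideanLength

variable {m k l : Type*} [Fintype m] [Fintype k] [Fintype l]

/-- Euclidean length of a vector. -/
def vlen (v : m → ℝ) : ℝ := ‖WithLp.toLp 2 v‖

theorem vlen_nonneg (v : m → ℝ) : 0 ≤ vlen v := norm_nonneg _

theorem vlen_sq (v : m → ℝ) : vlen v ^ 2 = v ⬝ᵥ v := by
  rw [vlen, EuclideanSpace.real_norm_sq_eq]
  simp [dotProduct, sq]

theorem abs_dotProduct_le_vlen_mul_vlen (v w : m → ℝ) : |v ⬝ᵥ w| ≤ vlen v * vlen w := by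
  have h := abs_real_inner_le_norm (WithLp.toLp 2 w) (WithLp.toLp 2 v)
  rw [EuclideanSpace.inner_toLp_toLp, mul_comm] at h
  simpa [vlen] using h

theorem dotProduct_le_vlen_mul_vlen (v w : m → ℝ) : v ⬝ᵥ w ≤ vlen v * vlen w :=
  (le_abs_self _).trans (abs_dotProduct_le_vlen_mul_vlen v w)

theorem neg_vlen_mul_vlen_le_dotProduct (v w : m → ℝ) : -(vlen v * vlen w) ≤ v ⬝ᵥ w :=
  (abs_le.mp (abs_dotProduct_le_vlen_mul_vlen v w)).1

theorem vlen_pos {v : m → ℝ} (hv : v ≠ 0) : 0 < vlen v := by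
  rw [vlen, norm_pos_iff]
  exact fun h => hv (by simpa using h)

theorem dotProduct_self_pos_of_ne_zero {v : m → ℝ} (hv : v ≠ 0) : 0 < v ⬝ᵥ v := by
  rw [← vlen_sq]
  exact pow_pos (vlen_pos hv) 2

theorem vlen_mulVec_le_opNorm [DecidableEq k] (M : Matrix m k ℝ) (v : k → ℝ) :
    vlen (M *ᵥ v) ≤ opNorm M * vlen v :=
  (LinearMap.toContinuousLinearMap (Matrix.toEuclideanLin M)).le_opNorm (WithLp.toLp 2 v)

theorem opNorm_nonneg [DecidableEq k] (M : Matrix m k ℝ) : 0 ≤ opNorm M := norm_nonneg _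

theorem frobNorm_sq (M : Matrix m k ℝ) : frobNorm M ^ 2 = ∑ i, ∑ j, M i j ^ 2 :=
  Real.sq_sqrt (Finset.sum_nonneg fun _ _ => Finset.sum_nonneg fun _ _ => sq_nonneg _)

theorem frobNorm_nonneg (M : Matrix m k ℝ) : 0 ≤ frobNorm M := Real.sqrt_nonneg _

theorem frobNorm_sq_eq_finner (M : Matrix m k ℝ) : frobNorm M ^ 2 = finner M M := by
  rw [frobNorm_sq]
  simp only [finner, sq]

theorem finner_eq_trace (X Y : Matrix m k ℝ) : finner X Y = (X * Yᵀ).trace := by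
  simp [finner, Matrix.trace, Matrix.mul_apply]

theorem transpose_mulVec_sq_le (M : Matrix m k ℝ) (v : m → ℝ) :
    (Mᵀ *ᵥ v) ⬝ᵥ (Mᵀ *ᵥ v) ≤ frobNorm M ^ 2 * (v ⬝ᵥ v) := by
  rw [frobNorm_sq, Finset.sum_comm, Finset.sum_mul]
  refine Finset.sum_le_sum fun j _ => ?_
  have h := Finset.sum_mul_sq_le_sq_mul_sq Finset.univ (fun i => M i j) v
  simpa [Matrix.mulVec, dotProduct, sq] using h

theorem vlen_transpose_mulVec_le_frobNorm (M : Matrix m k ℝ) (v : m → ℝ) :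
    vlen (Mᵀ *ᵥ v) ≤ frobNorm M * vlen v := by
  refine le_of_sq_le_sq ?_ (mul_nonneg (frobNorm_nonneg M) (vlen_nonneg v))
  rw [mul_pow, vlen_sq, vlen_sq]
  exact transpose_mulVec_sq_le M v

theorem mulVec_dotProduct_eq (M : Matrix m k ℝ) (v : k → ℝ) (w : m → ℝ) :
    (M *ᵥ v) ⬝ᵥ w = v ⬝ᵥ (Mᵀ *ᵥ w) := by
  rw [Matrix.dotProduct_mulVec, Matrix.vecMul_transpose]

theorem transpose_mulVec_dotProduct_transpose_mulVec [DecidableEq m] {Q : Matrix m k ℝ}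
    (hQ : Q * Qᵀ = 1) (v w : m → ℝ) : (Qᵀ *ᵥ v) ⬝ᵥ (Qᵀ *ᵥ w) = v ⬝ᵥ w := by
  rw [mulVec_dotProduct_eq, Matrix.transpose_transpose, Matrix.mulVec_mulVec, hQ,
    Matrix.one_mulVec]

theorem vlen_transpose_mulVec_eq [DecidableEq m] {Q : Matrix m k ℝ}
    (hQ : Q * Qᵀ = 1) (v : m → ℝ) : vlen (Qᵀ *ᵥ v) = vlen v := by
  rw [← sq_eq_sq₀ (vlen_nonneg _) (vlen_nonneg _), vlen_sq, vlen_sq,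
    transpose_mulVec_dotProduct_transpose_mulVec hQ]

end EuclideanLength

section PositiveSemidefinite

variable {m : Type*} [Fintype m] [DecidableEq m]

theorem posSemidef_of_eigenvalue_nonneg {M : Matrix m m ℝ} (hM : M.IsSymm)
    (h : ∀ (μ : ℝ) (v : m → ℝ), v ≠ 0 → M *ᵥ v = μ • v → 0 ≤ μ) : M.PosSemidef := by
  have hM' : M.IsHermitian := by
    rw [Matrix.IsHermitian, Matrix.conjTranspose_eq_transpose_of_trivial]
    exact hM
  rw [hM'.posSemidef_iff_eigenvalues_nonneg]
  refine fun i => h _ (hM'.eigenvectorBasis i) ?_ (hM'.mulVec_eigenvectorBasis i)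
  intro h0
  refine hM'.eigenvectorBasis.toBasis.ne_zero i ?_
  rw [OrthonormalBasis.coe_toBasis]
  ext j
  exact congrFun h0 j

omit [DecidableEq m] in
theorem Matrix.PosSemidef.dotProduct_mulVec_self_nonneg {M : Matrix m m ℝ} (hM : M.PosSemidef)
    (v : m → ℝ) : 0 ≤ v ⬝ᵥ (M *ᵥ v) := by
  simpa using hM.dotProduct_mulVec_nonneg v

theorem Matrix.PosSemidef.exists_eq_transpose_mul_self {M : Matrix m m ℝ} (hM : M.PosSemidef) :
    ∃ B : Matrix m m ℝ, M = Bᵀ * B := by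
  open scoped MatrixOrder Matrix.Norms.L2Operator in
  obtain ⟨B, hB⟩ := CStarAlgebra.nonneg_iff_eq_star_mul_self.mp hM.nonneg
  exact ⟨B, by rw [hB, Matrix.star_eq_conjTranspose,
    Matrix.conjTranspose_eq_transpose_of_trivial]⟩

theorem exists_finner_eq_finner_self {L Y : Matrix m m ℝ} (hL : L.PosSemidef)
    (hY : Y.PosSemidef) : ∃ G : Matrix m m ℝ, finner L Y = finner G G ∧ (G = 0 → L * Y = 0) := by
  obtain ⟨B, rfl⟩ := hL.exists_eq_transpose_mul_self
  obtain ⟨C, rfl⟩ := hY.exists_eq_transpose_mul_self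
  refine ⟨B * Cᵀ, ?_, fun h => ?_⟩
  · rw [finner_eq_trace, finner_eq_trace, Matrix.transpose_mul, Matrix.transpose_mul,
      Matrix.transpose_transpose, Matrix.mul_assoc,
      Matrix.trace_mul_comm Bᵀ]
    simp only [Matrix.mul_assoc]
  · rw [Matrix.mul_assoc, ← Matrix.mul_assoc B, h, Matrix.zero_mul, Matrix.mul_zero]

theorem finner_nonneg_of_posSemidef {L Y : Matrix m m ℝ} (hL : L.PosSemidef)
    (hY : Y.PosSemidef) : 0 ≤ finner L Y := by
  obtain ⟨G, hG, -⟩ := exists_finner_eq_finner_self hL hY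
  rw [hG, ← frobNorm_sq_eq_finner]
  positivity

theorem mul_eq_zero_of_finner_eq_zero {L Y : Matrix m m ℝ} (hL : L.PosSemidef)
    (hY : Y.PosSemidef) (h : finner L Y = 0) : L * Y = 0 := by
  obtain ⟨G, hG, hG0⟩ := exists_finner_eq_finner_self hL hY
  refine hG0 ?_
  rw [h, finner_eq_trace, ← Matrix.conjTranspose_eq_transpose_of_trivial, eq_comm,
    Matrix.trace_mul_conjTranspose_self_eq_zero_iff] at hG
  exact hG

end PositiveSemidefinite

section Blocks

variable {n d p : ℕ}

theorem Zmat_mulVec (u : Fin d → ℝ) (q : Fin n × Fin d) : (Zmat n d *ᵥ u) q = u q.2 := by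
  simp [Zmat, Matrix.mulVec, dotProduct]

theorem transpose_mulVec_eq_sum (M : Matrix (Fin n × Fin d) (Fin p) ℝ)
    (x : Fin n × Fin d → ℝ) :
    Mᵀ *ᵥ x = ∑ i, (rowBlk M i)ᵀ *ᵥ (fun k => x (i, k)) := by
  ext l
  simp [Matrix.mulVec, dotProduct, rowBlk, Fintype.sum_prod_type, Finset.sum_apply]

theorem blkDiag_mulVec (D : Fin n → Matrix (Fin d) (Fin d) ℝ) (x : Fin n × Fin d → ℝ)
    (q : Fin n × Fin d) : (blkDiag D *ᵥ x) q = (D q.1 *ᵥ fun k => x (q.1, k)) q.2 := by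
  simp [blkDiag, Matrix.mulVec, dotProduct, Fintype.sum_prod_type, Finset.sum_ite_eq]

theorem rowBlk_blkDiag_mul (D : Fin n → Matrix (Fin d) (Fin d) ℝ)
    (M : Matrix (Fin n × Fin d) (Fin p) ℝ) (i : Fin n) :
    rowBlk (blkDiag D * M) i = D i * rowBlk M i := by
  ext k l
  simp [rowBlk, blkDiag, Matrix.mul_apply, Fintype.sum_prod_type, Finset.sum_ite_eq]

theorem rowBlk_mul (M : Matrix (Fin n × Fin d) (Fin n × Fin d) ℝ)
    (S : Matrix (Fin n × Fin d) (Fin p) ℝ) (i : Fin n) :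
    rowBlk (M * S) i = ∑ j, blk M i j * rowBlk S j := by
  ext k l
  simp [rowBlk, blk, Matrix.mul_apply, Fintype.sum_prod_type, Matrix.sum_apply]

theorem rowBlk_sub (M N : Matrix (Fin n × Fin d) (Fin p) ℝ) (i : Fin n) :
    rowBlk (M - N) i = rowBlk M i - rowBlk N i := rfl

theorem rowBlk_Zmat_mul (Q : Matrix (Fin d) (Fin p) ℝ) (i : Fin n) :
    rowBlk (Zmat n d * Q) i = Q := by
  ext k l
  simp [rowBlk, Zmat, Matrix.mul_apply]

theorem blk_mul_transpose (M N : Matrix (Fin n × Fin d) (Fin p) ℝ) (i j : Fin n) :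
    blk (M * Nᵀ) i j = rowBlk M i * (rowBlk N j)ᵀ := rfl

theorem ext_rowBlk {M N : Matrix (Fin n × Fin d) (Fin p) ℝ}
    (h : ∀ i, rowBlk M i = rowBlk N i) : M = N := by
  ext ⟨i, k⟩ l
  exact congrFun (congrFun (h i) k) l

theorem frobNorm_sq_eq_sum_rowBlk (M : Matrix (Fin n × Fin d) (Fin p) ℝ) :
    frobNorm M ^ 2 = ∑ i, frobNorm (rowBlk M i) ^ 2 := by
  simp only [frobNorm_sq, Fintype.sum_prod_type, rowBlk]

theorem Matrix.IsSymm.blk_transpose {A : Matrix (Fin n × Fin d) (Fin n × Fin d) ℝ}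
    (hA : A.IsSymm) (i j : Fin n) : (blk A i j)ᵀ = blk A j i := by
  ext k l
  exact hA.apply (i, l) (j, k) |>.symm

theorem blkDiag_isSymm {D : Fin n → Matrix (Fin d) (Fin d) ℝ} (hD : ∀ i, (D i).IsSymm) :
    (blkDiag D).IsSymm := by
  ext ⟨i, k⟩ ⟨j, l⟩
  by_cases h : i = j
  · subst h
    simpa [blkDiag] using (hD i).apply k l
  · simp [blkDiag, h, Ne.symm h]

theorem Lam_isSymm {A : Matrix (Fin n × Fin d) (Fin n × Fin d) ℝ} (hA : A.IsSymm)
    (S : Matrix (Fin n × Fin d) (Fin p) ℝ) (i : Fin n) : (Lam A S i).IsSymm := by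
  rw [Matrix.IsSymm, Lam, Matrix.transpose_smul, Matrix.transpose_sum]
  congr 1
  refine Finset.sum_congr rfl fun j _ => ?_
  rw [Matrix.transpose_add, Matrix.transpose_mul, Matrix.transpose_mul, Matrix.transpose_mul,
    Matrix.transpose_mul, hA.blk_transpose, hA.blk_transpose, Matrix.transpose_transpose,
    add_comm, Matrix.mul_assoc, Matrix.mul_assoc]
  rfl

theorem finner_sub_left {m k : Type*} [Fintype m] [Fintype k] (X Y W : Matrix m k ℝ) :
    finner (X - Y) W = finner X W - finner Y W := by
  simp [finner, sub_mul, Finset.sum_sub_distrib]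

theorem finner_blkDiag (D : Fin n → Matrix (Fin d) (Fin d) ℝ)
    (Y : Matrix (Fin n × Fin d) (Fin n × Fin d) ℝ) :
    finner (blkDiag D) Y = ∑ i, finner (D i) (blk Y i i) := by
  simp [finner, blkDiag, blk, Fintype.sum_prod_type, Finset.sum_ite_eq]

theorem sdpFeasible_mul_transpose {S : Matrix (Fin n × Fin d) (Fin p) ℝ}
    (hS : StiefelBlocks S) : sdpFeasible (S * Sᵀ) := by
  refine ⟨?_, ?_, fun i => hS i⟩
  · rw [Matrix.IsSymm, Matrix.transpose_mul, Matrix.transpose_transpose]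
  · rw [← Matrix.conjTranspose_eq_transpose_of_trivial]
    exact Matrix.posSemidef_self_mul_conjTranspose S

/-- The dual certificate `Λ(S) - A`. -/
def certMat (A : Matrix (Fin n × Fin d) (Fin n × Fin d) ℝ)
    (S : Matrix (Fin n × Fin d) (Fin p) ℝ) : Matrix (Fin n × Fin d) (Fin n × Fin d) ℝ :=
  blkDiag (Lam A S) - A

theorem certMat_mul_self {A : Matrix (Fin n × Fin d) (Fin n × Fin d) ℝ}
    {S : Matrix (Fin n × Fin d) (Fin p) ℝ} (hS : firstOrderCrit A S) : certMat A S * S = 0 := by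
  refine ext_rowBlk fun i => ?_
  rw [certMat, Matrix.sub_mul, rowBlk_sub, rowBlk_blkDiag_mul, rowBlk_mul, hS i, sub_self]
  rfl

theorem certMat_isSymm {A : Matrix (Fin n × Fin d) (Fin n × Fin d) ℝ} (hA : A.IsSymm)
    (S : Matrix (Fin n × Fin d) (Fin p) ℝ) : (certMat A S).IsSymm :=
  (blkDiag_isSymm (Lam_isSymm hA S)).sub hA

theorem finner_certMat_of_feasible {A : Matrix (Fin n × Fin d) (Fin n × Fin d) ℝ}
    {S : Matrix (Fin n × Fin d) (Fin p) ℝ} {Y : Matrix (Fin n × Fin d) (Fin n × Fin d) ℝ}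
    (hY : sdpFeasible Y) :
    finner (certMat A S) Y = ∑ i, finner (Lam A S i) 1 - finner A Y := by
  rw [certMat, finner_sub_left, finner_blkDiag]
  simp only [hY.2.2]

theorem finner_certMat_self {A : Matrix (Fin n × Fin d) (Fin n × Fin d) ℝ}
    {S : Matrix (Fin n × Fin d) (Fin p) ℝ} (hS : firstOrderCrit A S) :
    finner (certMat A S) (S * Sᵀ) = 0 := by
  rw [finner_eq_trace, Matrix.transpose_mul, Matrix.transpose_transpose, ← Matrix.mul_assoc,
    certMat_mul_self hS, Matrix.zero_mul, Matrix.trace_zero]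

theorem rowBlk_mul_transpose_mulVec {A : Matrix (Fin n × Fin d) (Fin n × Fin d) ℝ} (hA : A.IsSymm)
    (S : Matrix (Fin n × Fin d) (Fin p) ℝ) (i : Fin n) (u : Fin d → ℝ) :
    (rowBlk (A * S) i)ᵀ *ᵥ u = Sᵀ *ᵥ (colBlk A i *ᵥ u) := by
  rw [Matrix.mulVec_mulVec]
  congr 1
  ext l k
  simp only [Matrix.transpose_apply, rowBlk, Matrix.mul_apply, colBlk]
  refine Finset.sum_congr rfl fun q _ => ?_
  rw [hA.apply, mul_comm]

end Blocks

section SpectralBounds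

variable {n d p : ℕ}

theorem correlation_lower_bound {S : Matrix (Fin n × Fin d) (Fin p) ℝ} (hS : StiefelBlocks S)
    {Q : Matrix (Fin d) (Fin p) ℝ} (hQ : Q * Qᵀ = 1) (u : Fin d → ℝ) :
    (n - frobNorm (S - Zmat n d * Q) ^ 2 / 2) * (u ⬝ᵥ u) ≤
      (Sᵀ *ᵥ (Zmat n d *ᵥ u)) ⬝ᵥ (Qᵀ *ᵥ u) := by
  have hterm : ∀ i, (1 - frobNorm (rowBlk (S - Zmat n d * Q) i) ^ 2 / 2) * (u ⬝ᵥ u) ≤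
      ((rowBlk S i)ᵀ *ᵥ u) ⬝ᵥ (Qᵀ *ᵥ u) := by
    intro i
    have h := transpose_mulVec_sq_le (rowBlk (S - Zmat n d * Q) i) u
    have h1 := transpose_mulVec_dotProduct_transpose_mulVec (hS i) u u
    have h2 := transpose_mulVec_dotProduct_transpose_mulVec hQ u u
    have h3 : (rowBlk (S - Zmat n d * Q) i)ᵀ *ᵥ u = (rowBlk S i)ᵀ *ᵥ u - Qᵀ *ᵥ u := by
      rw [rowBlk_sub, rowBlk_Zmat_mul, Matrix.transpose_sub, Matrix.sub_mulVec]
    rw [h3, sub_dotProduct, dotProduct_sub, dotProduct_sub,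
      dotProduct_comm (Qᵀ *ᵥ u) ((rowBlk S i)ᵀ *ᵥ u)] at h
    linarith
  rw [transpose_mulVec_eq_sum, sum_dotProduct]
  simp only [Zmat_mulVec]
  refine le_of_eq_of_le ?_ (Finset.sum_le_sum fun i _ => hterm i)
  rw [← Finset.sum_mul, Finset.sum_sub_distrib, ← Finset.sum_div, ← frobNorm_sq_eq_sum_rowBlk]
  simp

theorem exists_ne_zero_mulVec_eq_zero (hp : d < p) (M : Matrix (Fin d) (Fin p) ℝ) :
    ∃ v ≠ 0, M *ᵥ v = 0 := by
  have h : LinearMap.ker M.mulVecLin ≠ ⊥ := LinearMap.ker_ne_bot_of_finrank_lt (by simpa using hp)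
  obtain ⟨v, hv, hv0⟩ := Submodule.exists_mem_ne_zero_of_ne_bot h
  exact ⟨v, hv0, by simpa using hv⟩

theorem finner_vecMulVec_self {m : Type*} [Fintype m] (D : Matrix m m ℝ) (u : m → ℝ) :
    finner D (vecMulVec u u) = u ⬝ᵥ (D *ᵥ u) := by
  simp only [finner, vecMulVec_apply, dotProduct, mulVec, Finset.mul_sum]
  exact Finset.sum_congr rfl fun i _ => Finset.sum_congr rfl fun j _ => by ring

theorem finner_smul_right {m k : Type*} [Fintype m] [Fintype k] (X Y : Matrix m k ℝ) (c : ℝ) :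
    finner X (c • Y) = c * finner X Y := by
  simp only [finner, Finset.mul_sum, Matrix.smul_apply, smul_eq_mul]
  exact Finset.sum_congr rfl fun i _ => Finset.sum_congr rfl fun j _ => by ring

theorem finner_zero_right {m k : Type*} [Fintype m] [Fintype k] (X : Matrix m k ℝ) :
    finner X 0 = 0 := by
  simp [finner]

/-- Testing the second-order inequality with `u vᵀ` in a single block, where `v` is orthogonal to
the rows of `S i`, bounds `Λ i i` from below by the diagonal block of `A`. -/
theorem blk_quadForm_le_Lam_quadForm (hp : d < p)
    {A : Matrix (Fin n × Fin d) (Fin n × Fin d) ℝ} {S : Matrix (Fin n × Fin d) (Fin p) ℝ}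
    (hS : secondOrderIneq A S) (i : Fin n) (u : Fin d → ℝ) :
    u ⬝ᵥ (blk A i i *ᵥ u) ≤ u ⬝ᵥ (Lam A S i *ᵥ u) := by
  obtain ⟨v, hv, hSv⟩ := exists_ne_zero_mulVec_eq_zero hp (rowBlk S i)
  let Y : Matrix (Fin n × Fin d) (Fin p) ℝ := fun q l => if q.1 = i then u q.2 * v l else 0
  have hYi : rowBlk Y i = vecMulVec u v := by
    ext k l
    simp [rowBlk, Y, vecMulVec_apply]
  have hYj : ∀ j, j ≠ i → rowBlk Y j = 0 := by
    intro j hj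
    ext k l
    simp [rowBlk, Y, hj]
  have hYY : rowBlk Y i * (rowBlk Y i)ᵀ = (v ⬝ᵥ v) • vecMulVec u u := by
    rw [hYi, transpose_vecMulVec, vecMulVec_mul_vecMulVec, vecMulVec_smul]
  have h := hS Y ?_
  · rw [Finset.sum_eq_single i, Finset.sum_eq_single i, Finset.sum_eq_single i, hYY,
      finner_smul_right, finner_smul_right, finner_vecMulVec_self, finner_vecMulVec_self] at h
    · exact le_of_mul_le_mul_left h (dotProduct_self_pos_of_ne_zero hv)
    · intro j _ hj
      rw [hYj j hj, Matrix.zero_mul, finner_zero_right]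
    · simp
    · intro j _ hj
      rw [hYj j hj, Matrix.transpose_zero, Matrix.mul_zero, finner_zero_right]
    · simp
    · intro j _ hj
      refine Finset.sum_eq_zero fun l _ => ?_
      rw [hYj j hj, Matrix.zero_mul, finner_zero_right]
    · simp
  · intro j
    by_cases hj : j = i
    · subst hj
      rw [hYi, transpose_vecMulVec, mul_vecMulVec, hSv, zero_vecMulVec, zero_add,
        vecMulVec_mul, vecMul_transpose, hSv, vecMulVec_zero]
    · rw [hYj j hj, Matrix.transpose_zero, Matrix.mul_zero, Matrix.zero_mul, add_zero]

theorem Zmat_transpose_mulVec_dotProduct (x : Fin n × Fin d → ℝ) (Q : Matrix (Fin d) (Fin p) ℝ)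
    (u : Fin d → ℝ) (hQ : Q * Qᵀ = 1) :
    ((Zmat n d * Q)ᵀ *ᵥ x) ⬝ᵥ (Qᵀ *ᵥ u) = x ⬝ᵥ (Zmat n d *ᵥ u) := by
  rw [Matrix.transpose_mul, ← Matrix.mulVec_mulVec,
    transpose_mulVec_dotProduct_transpose_mulVec hQ, mulVec_dotProduct_eq,
    Matrix.transpose_transpose]

theorem colBlk_signal_add (Δ : Matrix (Fin n × Fin d) (Fin n × Fin d) ℝ) (i : Fin n) :
    colBlk (Zmat n d * (Zmat n d)ᵀ + Δ) i = Zmat n d + colBlk Δ i := by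
  ext q l
  simp [colBlk, Zmat, Matrix.mul_apply, eq_comm]

theorem Zmat_mul_transpose_isSymm : (Zmat n d * (Zmat n d)ᵀ).IsSymm := by
  rw [Matrix.IsSymm, Matrix.transpose_mul, Matrix.transpose_transpose]

theorem alignment_lower_bound {Δ : Matrix (Fin n × Fin d) (Fin n × Fin d) ℝ} (hΔ : Δ.IsSymm)
    {S : Matrix (Fin n × Fin d) (Fin p) ℝ} (hS : StiefelBlocks S)
    {Q : Matrix (Fin d) (Fin p) ℝ} (hQ : Q * Qᵀ = 1) (i : Fin n) (u : Fin d → ℝ) :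
    (n - frobNorm (S - Zmat n d * Q) ^ 2 / 2
        - frobNorm (S - Zmat n d * Q) * opNorm (colBlk Δ i)
        - opNorm ((colBlk Δ i)ᵀ * Zmat n d)) * vlen u ^ 2 ≤
      ((rowBlk ((Zmat n d * (Zmat n d)ᵀ + Δ) * S) i)ᵀ *ᵥ u) ⬝ᵥ (Qᵀ *ᵥ u) := by
  have hA := Zmat_mul_transpose_isSymm.add hΔ
  rw [rowBlk_mul_transpose_mulVec hA, colBlk_signal_add, Matrix.add_mulVec, Matrix.mulVec_add,
    add_dotProduct]
  have h1 := correlation_lower_bound hS hQ u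
  rw [← vlen_sq] at h1
  set E := S - Zmat n d * Q with hE
  have hSE : S = E + Zmat n d * Q := by rw [hE, sub_add_cancel]
  have h2 : (Sᵀ *ᵥ (colBlk Δ i *ᵥ u)) ⬝ᵥ (Qᵀ *ᵥ u) =
      (Eᵀ *ᵥ (colBlk Δ i *ᵥ u)) ⬝ᵥ (Qᵀ *ᵥ u) + u ⬝ᵥ (((colBlk Δ i)ᵀ * Zmat n d) *ᵥ u) := by
    conv_lhs => rw [hSE]
    rw [Matrix.transpose_add, Matrix.add_mulVec, add_dotProduct,
      Zmat_transpose_mulVec_dotProduct _ _ _ hQ, mulVec_dotProduct_eq _ u,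
      ← Matrix.mulVec_mulVec u (colBlk Δ i)ᵀ]
  have h3 : vlen (Eᵀ *ᵥ (colBlk Δ i *ᵥ u)) ≤ frobNorm E * (opNorm (colBlk Δ i) * vlen u) :=
    (vlen_transpose_mulVec_le_frobNorm _ _).trans
      (mul_le_mul_of_nonneg_left (vlen_mulVec_le_opNorm _ _) (frobNorm_nonneg _))
  have h4 := neg_vlen_mul_vlen_le_dotProduct (Eᵀ *ᵥ (colBlk Δ i *ᵥ u)) (Qᵀ *ᵥ u)
  have h5 := neg_vlen_mul_vlen_le_dotProduct u (((colBlk Δ i)ᵀ * Zmat n d) *ᵥ u)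
  have h6 := mul_le_mul_of_nonneg_left
    (vlen_mulVec_le_opNorm ((colBlk Δ i)ᵀ * Zmat n d) u) (vlen_nonneg u)
  have h7 := mul_le_mul_of_nonneg_right h3 (vlen_nonneg u)
  rw [vlen_transpose_mulVec_eq hQ] at h4
  rw [h2]
  linarith

/-- The eigenvalues of a symmetric positive semidefinite `D` are at least `c`, whenever the
products `Q * (D * T)ᵀ` are in quadratic form, for `T` and `Q` with orthonormal rows. -/
theorem quadForm_lower_bound {D : Matrix (Fin d) (Fin d) ℝ} (hD : D.IsSymm)
    (hpos : ∀ u, 0 ≤ u ⬝ᵥ (D *ᵥ u)) {T Q : Matrix (Fin d) (Fin p) ℝ} (hT : T * Tᵀ = 1)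
    (hQ : Q * Qᵀ = 1) {c : ℝ}
    (hc : ∀ u, c * vlen u ^ 2 ≤ ((D * T)ᵀ *ᵥ u) ⬝ᵥ (Qᵀ *ᵥ u)) (u : Fin d → ℝ) :
    c * vlen u ^ 2 ≤ u ⬝ᵥ (D *ᵥ u) := by
  have hpsd : (D - c • (1 : Matrix (Fin d) (Fin d) ℝ)).PosSemidef := by
    refine posSemidef_of_eigenvalue_nonneg (hD.sub (by simp [Matrix.IsSymm])) fun μ v hv hμ => ?_
    have hDv : D *ᵥ v = (μ + c) • v := by
      rw [Matrix.sub_mulVec, Matrix.smul_mulVec, Matrix.one_mulVec, sub_eq_iff_eq_add] at hμ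
      rw [hμ, add_smul]
    have hvv := dotProduct_self_pos_of_ne_zero hv
    have hμc : 0 ≤ μ + c := by
      have h := hpos v
      rw [hDv, dotProduct_smul, smul_eq_mul] at h
      exact nonneg_of_mul_nonneg_left h hvv
    have h := hc v
    rw [Matrix.transpose_mul, ← Matrix.mulVec_mulVec, hD.eq, hDv, Matrix.mulVec_smul,
      smul_dotProduct, smul_eq_mul] at h
    have h1 := dotProduct_le_vlen_mul_vlen (Tᵀ *ᵥ v) (Qᵀ *ᵥ v)
    rw [vlen_transpose_mulVec_eq hT, vlen_transpose_mulVec_eq hQ, ← sq] at h1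
    have h2 := h.trans (mul_le_mul_of_nonneg_left h1 hμc)
    have h3 := le_of_mul_le_mul_right h2 (pow_pos (vlen_pos hv) 2)
    linarith
  have h := hpsd.dotProduct_mulVec_self_nonneg u
  rw [Matrix.sub_mulVec, dotProduct_sub, Matrix.smul_mulVec, Matrix.one_mulVec, dotProduct_smul,
    smul_eq_mul, ← vlen_sq] at h
  linarith

theorem blkDiag_quadForm_lower_bound {D : Fin n → Matrix (Fin d) (Fin d) ℝ} {c : ℝ}
    (hD : ∀ i u, c * vlen u ^ 2 ≤ u ⬝ᵥ (D i *ᵥ u)) (x : Fin n × Fin d → ℝ) :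
    c * vlen x ^ 2 ≤ x ⬝ᵥ (blkDiag D *ᵥ x) := by
  have h := Finset.sum_le_sum fun i (_ : i ∈ Finset.univ) => hD i fun k => x (i, k)
  simp only [vlen_sq, ← Finset.mul_sum] at h ⊢
  simpa [dotProduct, Fintype.sum_prod_type, blkDiag_mulVec] using h

theorem certMat_quadForm_lower_bound (Δ : Matrix (Fin n × Fin d) (Fin n × Fin d) ℝ)
    (S : Matrix (Fin n × Fin d) (Fin p) ℝ) {c : ℝ}
    (hc : ∀ i u, c * vlen u ^ 2 ≤ u ⬝ᵥ (Lam (Zmat n d * (Zmat n d)ᵀ + Δ) S i *ᵥ u))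
    (x : Fin n × Fin d → ℝ) :
    (c - opNorm Δ) * vlen x ^ 2 - vlen ((Zmat n d)ᵀ *ᵥ x) ^ 2 ≤
      x ⬝ᵥ (certMat (Zmat n d * (Zmat n d)ᵀ + Δ) S *ᵥ x) := by
  have h1 := blkDiag_quadForm_lower_bound hc x
  have h2 := dotProduct_le_vlen_mul_vlen x (Δ *ᵥ x)
  have h3 := mul_le_mul_of_nonneg_left (vlen_mulVec_le_opNorm Δ x) (vlen_nonneg x)
  have h4 : x ⬝ᵥ ((Zmat n d * (Zmat n d)ᵀ) *ᵥ x) = vlen ((Zmat n d)ᵀ *ᵥ x) ^ 2 := by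
    rw [vlen_sq, mulVec_dotProduct_eq, Matrix.transpose_transpose, Matrix.mulVec_mulVec]
  rw [certMat, Matrix.sub_mulVec, Matrix.add_mulVec, dotProduct_sub, dotProduct_add, h4]
  linarith

theorem vlen_Zmat_transpose_mulVec_le {S : Matrix (Fin n × Fin d) (Fin p) ℝ}
    {Q : Matrix (Fin d) (Fin p) ℝ} (hQ : Q * Qᵀ = 1) {x : Fin n × Fin d → ℝ}
    (hx : Sᵀ *ᵥ x = 0) :
    vlen ((Zmat n d)ᵀ *ᵥ x) ≤ frobNorm (S - Zmat n d * Q) * vlen x := by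
  have h := vlen_transpose_mulVec_le_frobNorm (S - Zmat n d * Q) x
  have h1 : (S - Zmat n d * Q)ᵀ *ᵥ x = -(Qᵀ *ᵥ ((Zmat n d)ᵀ *ᵥ x)) := by
    rw [Matrix.transpose_sub, Matrix.sub_mulVec, hx, zero_sub, Matrix.transpose_mul,
      Matrix.mulVec_mulVec]
  have h2 : ∀ v : Fin p → ℝ, vlen (-v) = vlen v := fun v => by
    rw [← sq_eq_sq₀ (vlen_nonneg _) (vlen_nonneg _), vlen_sq, vlen_sq, neg_dotProduct_neg]
  rwa [h1, h2, vlen_transpose_mulVec_eq hQ] at h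

/-- A symmetric matrix that annihilates the columns of `S` and is positive on their orthogonal
complement is positive semidefinite. -/
theorem posSemidef_of_pos_on_orthogonal {m k : Type*} [Fintype m] [DecidableEq m] [Fintype k]
    {L : Matrix m m ℝ} {S : Matrix m k ℝ} (hL : L.IsSymm) (hLS : L * S = 0)
    (hpos : ∀ x, Sᵀ *ᵥ x = 0 → 0 ≤ x ⬝ᵥ (L *ᵥ x)) : L.PosSemidef := by
  refine posSemidef_of_eigenvalue_nonneg hL fun μ v hv hμ => ?_
  by_contra! hneg
  have hSL : Sᵀ * L = 0 := by
    rw [← hL.eq, ← Matrix.transpose_mul, hLS, Matrix.transpose_zero]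
  have hSv : Sᵀ *ᵥ v = 0 := by
    have h : Sᵀ *ᵥ (L *ᵥ v) = 0 := by rw [Matrix.mulVec_mulVec, hSL, Matrix.zero_mulVec]
    rw [hμ, Matrix.mulVec_smul] at h
    exact (smul_eq_zero.mp h).resolve_left hneg.ne
  have h := hpos v hSv
  rw [hμ, dotProduct_smul, smul_eq_mul] at h
  exact absurd h (not_le.mpr (mul_neg_of_neg_of_pos hneg (dotProduct_self_pos_of_ne_zero hv)))

end SpectralBounds

section KernelParametrization

variable {n d p : ℕ}

theorem rowBlk_mulVec (R : Matrix (Fin n × Fin d) (Fin p) ℝ) (v : Fin p → ℝ) (i : Fin n) :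
    (fun k => (R *ᵥ v) (i, k)) = rowBlk R i *ᵥ v := rfl

theorem eq_mulVec_of_mem_ker {L : Matrix (Fin n × Fin d) (Fin n × Fin d) ℝ}
    {R : Matrix (Fin n × Fin d) (Fin d) ℝ} {i : Fin n} (hLR : L * R = 0) (hR : rowBlk R i = 1)
    (hker : ∀ x, L *ᵥ x = 0 → (Zmat n d)ᵀ *ᵥ x = 0 → x = 0) {x : Fin n × Fin d → ℝ}
    (hx : L *ᵥ x = 0) : x = R *ᵥ fun k => x (i, k) := by
  have hinj : Function.Injective ((Zmat n d)ᵀ * R).mulVecLin := by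
    rw [← LinearMap.ker_eq_bot, LinearMap.ker_eq_bot']
    intro v hv
    rw [Matrix.mulVecLin_apply, ← Matrix.mulVec_mulVec] at hv
    have h := hker (R *ᵥ v) (by rw [Matrix.mulVec_mulVec, hLR, Matrix.zero_mulVec]) hv
    rw [← Matrix.one_mulVec v, ← hR, ← rowBlk_mulVec, h]
    rfl
  obtain ⟨y, hy⟩ := (LinearMap.injective_iff_surjective.mp hinj) ((Zmat n d)ᵀ *ᵥ x)
  have hxy : x = R *ᵥ y := by
    refine sub_eq_zero.mp (hker _ ?_ ?_)
    · rw [Matrix.mulVec_sub, hx, Matrix.mulVec_mulVec, hLR, Matrix.zero_mulVec, sub_zero]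
    · rw [Matrix.mulVec_sub, Matrix.mulVec_mulVec, ← hy, Matrix.mulVecLin_apply, sub_self]
  have hy' : (fun k => x (i, k)) = y := by
    rw [hxy, rowBlk_mulVec, hR, Matrix.one_mulVec]
  rw [hy', ← hxy]

theorem eq_mul_transpose_of_feasible {L Y : Matrix (Fin n × Fin d) (Fin n × Fin d) ℝ}
    {R : Matrix (Fin n × Fin d) (Fin d) ℝ} {i : Fin n} (hLR : L * R = 0) (hR : rowBlk R i = 1)
    (hker : ∀ x, L *ᵥ x = 0 → (Zmat n d)ᵀ *ᵥ x = 0 → x = 0) (hY : sdpFeasible Y)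
    (hLY : L * Y = 0) : Y = R * Rᵀ := by
  have hcol : ∀ q r, Y q r = ∑ m, R q m * Y (i, m) r := by
    intro q r
    have h : L *ᵥ (fun q => Y q r) = 0 := funext fun q => congrFun (congrFun hLY q) r
    exact congrFun (eq_mulVec_of_mem_ker hLR hR hker h) q
  have hdiag : ∀ m k, Y (i, m) (i, k) = (1 : Matrix (Fin d) (Fin d) ℝ) m k :=
    fun m k => congrFun (congrFun (hY.2.2 i) m) k
  have hrow : ∀ m r, Y (i, m) r = R r m := by
    intro m r
    rw [← hY.1.apply, hcol]
    simp [hdiag, Matrix.one_apply]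
  ext q r
  rw [hcol, Matrix.mul_apply]
  simp only [hrow, Matrix.transpose_apply]

theorem rank_mul_transpose_of_rowBlk_eq_one {R : Matrix (Fin n × Fin d) (Fin d) ℝ} {i : Fin n}
    (hR : rowBlk R i = 1) : (R * Rᵀ).rank = d := by
  have hinj : Function.Injective R.mulVecLin := by
    intro v w h
    have h' : (fun k => (R *ᵥ v) (i, k)) = fun k => (R *ᵥ w) (i, k) :=
      funext fun k => congrFun h (i, k)
    rwa [rowBlk_mulVec, rowBlk_mulVec, hR, Matrix.one_mulVec, Matrix.one_mulVec] at h'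
  rw [Matrix.rank_self_mul_transpose, Matrix.rank, LinearMap.finrank_range_of_inj hinj]
  simp

/-- Dual certification: a feasible `S` with positive semidefinite certificate whose kernel meets
`ker Zᵀ` trivially is the unique maximizer, and it comes from orthogonal blocks. -/
theorem optimality_of_certificate {A : Matrix (Fin n × Fin d) (Fin n × Fin d) ℝ}
    {S : Matrix (Fin n × Fin d) (Fin p) ℝ} (i : Fin n) (hS : StiefelBlocks S)
    (hfirst : firstOrderCrit A S) (hpsd : (certMat A S).PosSemidef)
    (hker : ∀ x, certMat A S *ᵥ x = 0 → (Zmat n d)ᵀ *ᵥ x = 0 → x = 0) :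
    sdpMaximizer A (S * Sᵀ) ∧
    (∀ Y, sdpMaximizer A Y → Y = S * Sᵀ) ∧
    (S * Sᵀ).rank = d ∧
    ∃ R : Matrix (Fin n × Fin d) (Fin d) ℝ,
      progPMaximizer A R ∧ S * Sᵀ = R * Rᵀ ∧
      finner A (S * Sᵀ) = finner A (R * Rᵀ) := by
  have hfeas := sdpFeasible_mul_transpose hS
  have hval := finner_certMat_self hfirst
  rw [finner_certMat_of_feasible hfeas] at hval
  have hmax : sdpMaximizer A (S * Sᵀ) := by
    refine ⟨hfeas, fun Y hY => ?_⟩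
    have h := finner_nonneg_of_posSemidef hpsd hY.2.1
    rw [finner_certMat_of_feasible hY] at h
    linarith
  have hLS := certMat_mul_self hfirst
  have hLR : certMat A S * (S * (rowBlk S i)ᵀ) = 0 := by
    rw [← Matrix.mul_assoc, hLS, Matrix.zero_mul]
  have hR : rowBlk (S * (rowBlk S i)ᵀ) i = 1 := hS i
  have hSR := eq_mul_transpose_of_feasible hLR hR hker hfeas
    (by rw [← Matrix.mul_assoc, hLS, Matrix.zero_mul])
  refine ⟨hmax, fun Y hY => ?_, ?_, S * (rowBlk S i)ᵀ, ⟨fun j => ?_, fun R' hR' => ?_⟩, hSR, ?_⟩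
  · rw [hSR]
    refine eq_mul_transpose_of_feasible hLR hR hker hY.1
      (mul_eq_zero_of_finner_eq_zero hpsd hY.1.2.1 ?_)
    rw [finner_certMat_of_feasible hY.1]
    linarith [hY.2 _ hfeas, hmax.2 Y hY.1]
  · rw [hSR]
    exact rank_mul_transpose_of_rowBlk_eq_one hR
  · rw [← blk_mul_transpose, ← hSR]
    exact hS j
  · rw [← hSR]
    exact hmax.2 _ (sdpFeasible_mul_transpose hR')
  · rw [← hSR]

theorem exists_frobNorm_lt_of_dF_lt {S : Matrix (Fin n × Fin d) (Fin p) ℝ} (i : Fin n)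
    (hS : StiefelBlocks S) {b : ℝ} (h : dF S < b) :
    ∃ Q : Matrix (Fin d) (Fin p) ℝ, Q * Qᵀ = 1 ∧ frobNorm (S - Zmat n d * Q) < b := by
  obtain ⟨_, ⟨Q, hQ, rfl⟩, hlt⟩ := exists_lt_of_csInf_lt (s := {c | ∃ Q : Matrix (Fin d) (Fin p) ℝ,
    Q * Qᵀ = 1 ∧ c = frobNorm (S - Zmat n d * Q)}) ⟨_, rowBlk S i, hS i, rfl⟩ h
  exact ⟨Q, hQ, hlt⟩

end KernelParametrization

/-- global optimality of second-order critical points satisfying the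
proximity condition (Proposition 5.7). -/
theorem socp_global_optimality {n d p : ℕ} (hn : 2 ≤ n) (hd : 1 ≤ d) (hp : d + 1 ≤ p)
    (Δ : Matrix (Fin n × Fin d) (Fin n × Fin d) ℝ)
    (hΔsym : Δ.IsSymm) (hΔdiag : ∀ i, blk Δ i i = 0)
    (A : Matrix (Fin n × Fin d) (Fin n × Fin d) ℝ)
    (hA : A = Zmat n d * (Zmat n d)ᵀ + Δ)
    (δ : ℝ) (hδ : 0 < δ)
    (S : Matrix (Fin n × Fin d) (Fin p) ℝ) (hS : secondOrderCrit A S)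
    (hprox : dF S ≤ δ * Real.sqrt ((d : ℝ) / n) * opNorm Δ)
    (hcond : (n : ℝ) >
        3 * δ ^ 2 * d * opNorm Δ ^ 2 / (2 * n)
        + δ * Real.sqrt ((d : ℝ) / n) * opNorm Δ * (⨆ i, opNorm (colBlk Δ i))
        + (⨆ i, opNorm ((colBlk Δ i)ᵀ * Zmat n d))
        + opNorm Δ) :
    sdpMaximizer A (S * Sᵀ) ∧
    (∀ Y, sdpMaximizer A Y → Y = S * Sᵀ) ∧
    (S * Sᵀ).rank = d ∧
    ∃ R : Matrix (Fin n × Fin d) (Fin d) ℝ,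
      progPMaximizer A R ∧ S * Sᵀ = R * Rᵀ ∧
      finner A (S * Sᵀ) = finner A (R * Rᵀ) := by
  subst hA
  obtain ⟨hSt, hfirst, hsecond⟩ := hS
  have i₀ : Fin n := ⟨0, by omega⟩
  set M := ⨆ i, opNorm (colBlk Δ i)
  set C := ⨆ i, opNorm ((colBlk Δ i)ᵀ * Zmat n d)
  have hM0 : 0 ≤ M := Real.iSup_nonneg fun i => opNorm_nonneg _
  have hMi : ∀ i, opNorm (colBlk Δ i) ≤ M :=
    fun i => le_ciSup (f := fun i => opNorm (colBlk Δ i)) (Set.finite_range _).bddAbove i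
  have hCi : ∀ i, opNorm ((colBlk Δ i)ᵀ * Zmat n d) ≤ C :=
    fun i => le_ciSup (f := fun i => opNorm ((colBlk Δ i)ᵀ * Zmat n d))
      (Set.finite_range _).bddAbove i
  obtain ⟨Q, hQ, hgap⟩ : ∃ Q : Matrix (Fin d) (Fin p) ℝ, Q * Qᵀ = 1 ∧
      3 / 2 * frobNorm (S - Zmat n d * Q) ^ 2 + frobNorm (S - Zmat n d * Q) * M + C + opNorm Δ
        < n := by
    set b := δ * Real.sqrt ((d : ℝ) / n) * opNorm Δ with hb
    have hb2 : 3 * δ ^ 2 * d * opNorm Δ ^ 2 / (2 * n) = 3 / 2 * b ^ 2 := by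
      rw [hb, mul_pow, mul_pow, Real.sq_sqrt (by positivity)]
      ring
    rw [hb2] at hcond
    have hcont : ContinuousAt (fun t : ℝ => 3 / 2 * t ^ 2 + t * M + C + opNorm Δ) b := by fun_prop
    obtain ⟨b', hb', hbb'⟩ := ((hcont.eventually_lt continuousAt_const hcond).filter_mono
      nhdsWithin_le_nhds |>.and (self_mem_nhdsWithin (s := Set.Ioi b))).exists
    obtain ⟨Q, hQ, hlt⟩ := exists_frobNorm_lt_of_dF_lt i₀ hSt (hprox.trans_lt hbb')
    have he := frobNorm_nonneg (S - Zmat n d * Q)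
    refine ⟨Q, hQ, lt_of_le_of_lt ?_ hb'⟩
    gcongr
  set e := frobNorm (S - Zmat n d * Q) with he
  have he0 : 0 ≤ e := frobNorm_nonneg _
  have hblk : ∀ i, blk (Zmat n d * (Zmat n d)ᵀ + Δ) i i = 1 := by
    intro i
    ext k l
    have h := congrFun (congrFun (hΔdiag i) k) l
    simp only [blk, Matrix.zero_apply] at h
    simp [blk, Zmat, Matrix.mul_apply, h, Matrix.one_apply]
  have hsymm := Zmat_mul_transpose_isSymm.add hΔsym
  have hpos : ∀ i u, 0 ≤ u ⬝ᵥ (Lam (Zmat n d * (Zmat n d)ᵀ + Δ) S i *ᵥ u) := by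
    intro i u
    refine le_trans ?_ (blk_quadForm_le_Lam_quadForm hp hsecond i u)
    rw [hblk, Matrix.one_mulVec, ← vlen_sq]
    positivity
  have hLam : ∀ i u, (n - e ^ 2 / 2 - e * M - C) * vlen u ^ 2 ≤
      u ⬝ᵥ (Lam (Zmat n d * (Zmat n d)ᵀ + Δ) S i *ᵥ u) := by
    intro i
    refine quadForm_lower_bound (Lam_isSymm hsymm S i) (hpos i) (hSt i) hQ fun u => ?_
    rw [← hfirst i, ← rowBlk_mul]
    refine le_trans (mul_le_mul_of_nonneg_right ?_ (sq_nonneg _))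
      (alignment_lower_bound hΔsym hSt hQ i u)
    have h1 := mul_le_mul_of_nonneg_left (hMi i) he0
    linarith [hCi i]
  have hquad := certMat_quadForm_lower_bound Δ S hLam
  refine optimality_of_certificate i₀ hSt hfirst ?_ fun x hLx hZx => ?_
  · refine posSemidef_of_pos_on_orthogonal (certMat_isSymm hsymm S) (certMat_mul_self hfirst)
      fun x hx => le_trans ?_ (hquad x)
    have h := pow_le_pow_left₀ (vlen_nonneg _) (vlen_Zmat_transpose_mulVec_le hQ hx) 2
    rw [mul_pow, ← he] at h
    have h' : 0 ≤ (n - e ^ 2 / 2 - e * M - C - opNorm Δ - e ^ 2) * vlen x ^ 2 :=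
      mul_nonneg (by linarith) (sq_nonneg _)
    linarith
  · by_contra hx
    have h := hquad x
    rw [hLx, dotProduct_zero, hZx, vlen_sq 0, dotProduct_zero, sub_zero] at h
    refine absurd h (not_le.mpr (mul_pos ?_ (pow_pos (vlen_pos hx) 2)))
    linarith [sq_nonneg e]
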